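/- arXiv:2403.10828 — 3 statements merged into one kernel-verified Lean document; each statement's English description precedes it below -/
import Mathlib

section
/- Let G and G_T be commutative groups (written multiplicatively), let g ∈ G, h ∈ G_T, and let e : G → G → G_T be a map satisfying the bilinear-pairing law e(g^a, g^b) = h^(a·b) for all integers a, b. Let φ, ψ ∈ ℤ[X] and i, α ∈ ℤ satisfy the quotient identity φ − C(φ(i)) = ψ · (X − C(i)). Set the commitment C := g^(φ(α)) and the evaluation proof π := g^(ψ(α)). Then the KZG verification equation holds: e(C · (g^(φ(i)))⁻¹, g) = e(π, g^α · (g^i)⁻¹). -/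
/-- Completeness of KZG `VerifyEval`: given a pairing-like map `e` satisfying
`e (g^a) (g^b) = h^(a*b)` for all integers `a b`, and polynomials `φ ψ : ℤ[X]` with
`φ - C (φ.eval i) = ψ * (X - C i)`, the honestly computed commitment `C = g^(φ.eval α)`
and proof `π = g^(ψ.eval α)` pass the verification equation
`e (C / g^(φ.eval i)) g = e π (g^α / g^i)`. -/
theorem kzg_verifyEval_completeness
    (G GT : Type*) [CommGroup G] [CommGroup GT]
    (g : G) (h : GT) (e : G → G → GT)
    (he : ∀ a b : ℤ, e (g ^ a) (g ^ b) = h ^ (a * b))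
    (φ ψ : Polynomial ℤ) (i α : ℤ)
    (hquot : φ - Polynomial.C (φ.eval i) = ψ * (Polynomial.X - Polynomial.C i)) :
    e ((g ^ φ.eval α) * (g ^ φ.eval i)⁻¹) g = e (g ^ ψ.eval α) ((g ^ α) * (g ^ i)⁻¹) := by
  have hα : φ.eval α - φ.eval i = ψ.eval α * (α - i) := by
    simpa using congrArg (Polynomial.eval α) hquot
  have hg := he (φ.eval α - φ.eval i) 1
  rw [zpow_one, mul_one] at hg
  rw [← zpow_sub, ← zpow_sub, hg, he, hα]
end

section
/- Let n be a natural number and k ≥ 1, and let Surj(n, k) denote the number of surjective functions from Fin n onto Fin k. Then the recovery probability is monotone nonincreasing in the number of parts: Surj(n, k + 1)/(k + 1)^n ≤ Surj(n, k)/k^n (as real numbers). -/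
/-- `Surj n k` is the number of surjective functions from `Fin n` onto `Fin k`. -/
noncomputable def Surj (n k : ℕ) : ℕ :=
  Fintype.card {f : Fin n → Fin k // Function.Surjective f}

/-- Recolour a colour of `Fin (k + 1)` into `Fin k`, replacing the last colour by the spare colour
`b`; the second component records what is needed to recover both inputs. -/
def recolor {k : ℕ} (a : Fin (k + 1)) (b : Fin k) : Fin k × Fin (k + 1) :=
  Fin.lastCases (motive := fun _ => Fin k × Fin (k + 1)) (b, Fin.last k)
    (fun a' => (a', b.castSucc)) a

@[simp]
lemma recolor_last {k : ℕ} (b : Fin k) : recolor (Fin.last k) b = (b, Fin.last k) := by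
  simp [recolor]

@[simp]
lemma recolor_castSucc {k : ℕ} (a b : Fin k) : recolor a.castSucc b = (a, b.castSucc) := by
  simp [recolor]

lemma recolor_inj {k : ℕ} {a a' : Fin (k + 1)} {b b' : Fin k}
    (h : recolor a b = recolor a' b') : a = a' ∧ b = b' := by
  induction a using Fin.lastCases <;> induction a' using Fin.lastCases <;>
    simp_all [Fin.castSucc_ne_last, (Fin.castSucc_ne_last _).symm]

lemma surjective_recolor {α : Type*} {k : ℕ} {f : α → Fin (k + 1)} (hf : Function.Surjective f)
    (g : α → Fin k) : Function.Surjective fun i => (recolor (f i) (g i)).1 := by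
  intro a
  obtain ⟨i, hi⟩ := hf a.castSucc
  exact ⟨i, by simp [hi]⟩

lemma surj_succ_mul_pow_le (n k : ℕ) : Surj n (k + 1) * k ^ n ≤ Surj n k * (k + 1) ^ n := by
  let φ : {f : Fin n → Fin (k + 1) // Function.Surjective f} × (Fin n → Fin k) →
      {f : Fin n → Fin k // Function.Surjective f} × (Fin n → Fin (k + 1)) := fun p =>
    (⟨_, surjective_recolor p.1.2 p.2⟩, fun i => (recolor (p.1.1 i) (p.2 i)).2)
  have hφ : Function.Injective φ := by
    rintro ⟨⟨f, hf⟩, g⟩ ⟨⟨f', hf'⟩, g'⟩ h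
    simp only [φ, Prod.mk.injEq, Subtype.mk.injEq, funext_iff] at h
    have key i := recolor_inj (Prod.ext (h.1 i) (h.2 i))
    simp only [Prod.mk.injEq, Subtype.mk.injEq, funext_iff]
    exact ⟨fun i => (key i).1, fun i => (key i).2⟩
  simpa [Surj, Fintype.card_prod] using Fintype.card_le_of_injective φ hφ

/-- The recovery probability `Surj n k / k^n` of the partial-storage scheme is monotone
nonincreasing in the number of parts `k`. -/
theorem recovery_prob_antitone_in_parts (n k : ℕ) (hk : 1 ≤ k) :
    (Surj n (k + 1) : ℝ) / ((k : ℝ) + 1) ^ n ≤ (Surj n k : ℝ) / (k : ℝ) ^ n := by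
  have hk' : (0 : ℝ) < k := by exact_mod_cast hk
  rw [div_le_div_iff₀ (by positivity) (by positivity)]
  exact_mod_cast surj_succ_mul_pow_le n k
end

section
/- Let n, k be natural numbers with k ≥ 1 and let f ∈ [0, 1] be a real failure probability. Consider n builders whose states are independent and identically distributed on Option (Fin k), each builder failing (state = none) with probability f and otherwise storing a uniformly random part (state = some i with probability (1 − f)/k for each i ∈ Fin k). Then the probability that every part is stored by at least one surviving builder, i.e. the event {g : Fin n → Option (Fin k) | ∀ i : Fin k, ∃ b, g b = some i}, equals ∑_{j=0}^{k} (−1)^j · C(k, j) · (1 − (1 − f)·j/k)^n. -/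
open scoped ENNReal

/-- Discrete measurable structure on `Option α` (every set is measurable), appropriate for the
countable state space `Option (Fin k)` of a builder. -/
instance optionMeasurableSpace {α : Type*} : MeasurableSpace (Option α) := ⊤

open MeasureTheory in
/-- Inclusion-exclusion for the measure of a set of points avoiding finitely many events of a
finite space. -/
theorem measureReal_inf_compl_eq_sum_powerset {α ι : Type*} [Fintype α] [DecidableEq α]
    [MeasurableSpace α] [MeasurableSingletonClass α] (μ : Measure α) [IsFiniteMeasure μ]
    (s : Finset ι) (S : ι → Finset α) :
    μ.real (s.inf fun i => (S i)ᶜ : Finset α) =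
      ∑ t ∈ s.powerset, (-1 : ℝ) ^ t.card * μ.real (t.inf S : Finset α) := by
  have h := Finset.inclusion_exclusion_sum_inf_compl s S fun a => μ.real {a}
  simp only [sum_measureReal_singleton, zsmul_eq_mul] at h
  simpa using h

open MeasureTheory in
/-- The mass that a distribution on `Option α` with constant value `c` on `some` gives to the
complement of finitely many values `some i`. -/
theorem PMF.toMeasure_real_compl_map_some {α : Type*} (p : PMF (Option α)) {c : ℝ}
    (hc : 0 ≤ c) (hp : ∀ i, p (some i) = ENNReal.ofReal c) (t : Finset α) :
    p.toMeasure.real ((t.map Function.Embedding.some : Finset (Option α)) : Set (Option α))ᶜ =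
      1 - t.card * c := by
  have : DiscreteMeasurableSpace (Option α) := ⟨fun _ => trivial⟩
  rw [probReal_compl_eq_one_sub (.of_discrete), ← sum_measureReal_singleton, Finset.sum_map]
  simp [Measure.real, PMF.toMeasure_apply_singleton, hp, hc]

/-- Partial storage with failures: each of `n` builders independently fails with probability `f`
(state `none`) and otherwise stores a uniformly random one of `k` parts (state `some i` with
probability `(1 - f)/k`). Under the `n`-fold product of this distribution, the probability that
every part is stored by at least one surviving builder equals
`∑_{j=0}^{k} (-1)^j ⬝ C(k, j) ⬝ (1 - (1 - f)⬝j/k)^n`. -/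
theorem recovery_prob_with_failures (n k : ℕ) (hk : 1 ≤ k)
    (f : ℝ) (hf0 : 0 ≤ f) (hf1 : f ≤ 1)
    (p : PMF (Option (Fin k)))
    (hnone : p none = ENNReal.ofReal f)
    (hsome : ∀ i : Fin k, p (some i) = ENNReal.ofReal ((1 - f) / (k : ℝ))) :
    ((MeasureTheory.Measure.pi (fun _ : Fin n => p.toMeasure))
        {g : Fin n → Option (Fin k) | ∀ i : Fin k, ∃ b : Fin n, g b = some i}).toReal =
      ∑ j ∈ Finset.range (k + 1),
        (-1 : ℝ) ^ j * (k.choose j : ℝ) * (1 - (1 - f) * (j : ℝ) / (k : ℝ)) ^ n := by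
  classical
  have : DiscreteMeasurableSpace (Option (Fin k)) := ⟨fun _ => trivial⟩
  set μ := MeasureTheory.Measure.pi (fun _ : Fin n => p.toMeasure)
  let S : Fin k → Finset (Fin n → Option (Fin k)) := fun i => {g | ∀ b, g b ≠ some i}
  have hE : {g : Fin n → Option (Fin k) | ∀ i : Fin k, ∃ b : Fin n, g b = some i} =
      ((Finset.univ.inf fun i => (S i)ᶜ : Finset _) : Set (Fin n → Option (Fin k))) := by
    ext g
    simp [S, Finset.mem_inf]
  have hS (t : Finset (Fin k)) :
      μ.real (t.inf S : Finset _) = (1 - (1 - f) * (t.card : ℝ) / (k : ℝ)) ^ n := by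
    have ht : ((t.inf S : Finset _) : Set (Fin n → Option (Fin k))) =
        Set.univ.pi fun _ =>
          ((t.map Function.Embedding.some : Finset (Option (Fin k))) : Set (Option (Fin k)))ᶜ := by
      ext g
      simp only [S, Finset.mem_coe, Finset.mem_inf, Finset.mem_filter, Finset.mem_univ, true_and,
        Set.mem_pi, Set.mem_univ, Set.mem_compl_iff, Finset.mem_map, forall_const,
        Function.Embedding.some_apply, not_exists, not_and]
      exact ⟨fun h b i hi e => h i hi b e.symm, fun h i hi b e => h b i hi e.symm⟩
    rw [ht, MeasureTheory.Measure.real, MeasureTheory.Measure.pi_pi, ENNReal.toReal_prod]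
    change ∏ _ : Fin n, p.toMeasure.real _ = _
    rw [PMF.toMeasure_real_compl_map_some p (div_nonneg (sub_nonneg.2 hf1) k.cast_nonneg) hsome,
      Finset.prod_const, Finset.card_univ, Fintype.card_fin, mul_div_assoc', mul_comm (1 - f)]
  rw [hE]
  change μ.real _ = _
  rw [measureReal_inf_compl_eq_sum_powerset]
  simp only [hS]
  rw [Finset.sum_powerset_apply_card
    (fun j : ℕ => (-1 : ℝ) ^ j * (1 - (1 - f) * (j : ℝ) / (k : ℝ)) ^ n), Finset.card_univ,
    Fintype.card_fin]
  refine Finset.sum_congr rfl fun j _ => ?_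
  rw [nsmul_eq_mul]
  ring
end
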